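/- Let T be the Bolyai–Rényi map and let μ be any T-invariant Borel probability measure on [0,1) that is absolutely continuous with respect to Lebesgue measure. Then the metric entropy h(μ) = ∫ log(2x+2) dμ(x) satisfies |h(μ) − 1.05631307407297055209956887706406516793354262184005| ≤ 10⁻⁵⁰. -/

import Mathlib

open MeasureTheory Real Filter

/-- The Bolyai–Rényi map. -/
noncomputable def T (x : ℝ) : ℝ :=
  if x < Real.sqrt 2 - 1 then x ^ 2 + 2 * x
  else if x < Real.sqrt 3 - 1 then x ^ 2 + 2 * x - 1
  else x ^ 2 + 2 * x - 2

namespace BR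

/-! ### Integer polynomials as coefficient lists -/

/-- Evaluation of a coefficient list (lowest degree first). -/
def ev {R : Type} [CommRing R] : List ℤ → R → R
  | [], _ => 0
  | a :: p, x => (a : R) + x * ev p x

/-- Evaluation over the integers, in the form used for computations. -/
def evI : List ℤ → ℤ → ℤ
  | [], _ => 0
  | a :: p, x => Int.add a (Int.mul x (evI p x))

def padd : List ℤ → List ℤ → List ℤ
  | [], q => q
  | a :: p, [] => a :: p
  | a :: p, b :: q => (a + b) :: padd p q

def smul (c : ℤ) : List ℤ → List ℤ
  | [] => []
  | a :: p => (c * a) :: smul c p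

def pmul : List ℤ → List ℤ → List ℤ
  | [], _ => []
  | a :: p, q => padd (smul a q) (0 :: pmul p q)

/-- `pcomp c d p` is the polynomial `p (c + d u)`. -/
def pcomp (c d : ℤ) : List ℤ → List ℤ
  | [] => []
  | a :: p => padd (smul c (pcomp c d p)) (a :: smul d (pcomp c d p))

def dern : ℤ → List ℤ → List ℤ
  | _, [] => []
  | n, a :: p => (n * a) :: dern (n + 1) p

/-- Derivative. -/
def der (p : List ℤ) : List ℤ := dern 1 p.tail

/-- Even and odd parts. -/
def split : List ℤ → List ℤ × List ℤ
  | [] => ([], [])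
  | a :: p => (a :: (split p).2, (split p).1)

/-- Bound on the values for `|x| ≤ b`. -/
def nev (b : ℕ) : List ℤ → ℕ
  | [] => 0
  | a :: p => Nat.add a.natAbs (Nat.mul b (nev b p))

/-- Lipschitz bound for `|x| ≤ b`. -/
def lipb (b : ℕ) : List ℤ → ℕ
  | [] => 0
  | _ :: p => Nat.add (nev b p) (Nat.mul b (lipb b p))

/-- Rounded Taylor coefficients of `1/√(v + 2u)`. -/
def rgen (v : ℤ) : ℕ → ℤ → ℤ → List ℤ
  | 0, _, _ => []
  | n + 1, j, t => t :: rgen v n (j + 1) (-(t * (2 * j + 1) / ((j + 1) * v)))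

/-- Balanced digits in base `B`. -/
def dig (B H : ℤ) : ℕ → ℤ → List ℤ
  | 0, _ => []
  | n + 1, m => ((m + H) % B - H) :: dig B H n ((m + H) / B)

section lists
variable {R : Type} [CommRing R]

theorem evI_eq (p : List ℤ) (x : ℤ) : evI p x = ev p x := by
  induction p with
  | nil => rfl
  | cons a p ih =>
    show a + x * evI p x = (a : ℤ) + x * ev p x
    rw [ih]

theorem ev_intCast (p : List ℤ) (x : ℤ) : ev p (x : ℝ) = (evI p x : ℤ) := by
  induction p with
  | nil => simp [ev, evI]
  | cons a p ih =>
    show (a : ℝ) + x * ev p (x : ℝ) = ((a + x * evI p x : ℤ) : ℝ)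
    rw [ih]; push_cast; ring

theorem ev_padd (p q : List ℤ) (x : R) : ev (padd p q) x = ev p x + ev q x := by
  induction p generalizing q with
  | nil => simp [padd, ev]
  | cons a p ih =>
    cases q with
    | nil => simp [padd, ev]
    | cons b q => simp only [padd, ev, ih]; push_cast; ring

theorem ev_smul (c : ℤ) (p : List ℤ) (x : R) : ev (smul c p) x = c * ev p x := by
  induction p with
  | nil => simp [smul, ev]
  | cons a p ih => simp only [smul, ev, ih]; push_cast; ring

theorem ev_pmul (p q : List ℤ) (x : R) : ev (pmul p q) x = ev p x * ev q x := by
  induction p with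
  | nil => simp [pmul, ev]
  | cons a p ih => simp only [pmul, ev, ev_padd, ev_smul, ih]; push_cast; ring

theorem ev_pcomp (c d : ℤ) (p : List ℤ) (x : R) :
    ev (pcomp c d p) x = ev p ((c : R) + d * x) := by
  induction p with
  | nil => simp [pcomp, ev]
  | cons a p ih => simp only [pcomp, ev, ev_padd, ev_smul, ih]; ring

theorem ev_split (p : List ℤ) (s : R) :
    ev p s = ev (split p).1 (s ^ 2) + s * ev (split p).2 (s ^ 2) := by
  induction p with
  | nil => simp [split, ev]
  | cons a p ih => simp only [split, ev]; rw [ih]; ring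

theorem ev_dern (p : List ℤ) : ∀ (n : ℤ) (x d : ℝ), HasDerivAt (fun y : ℝ => ev p y) d x →
    ev (dern n p) x = n * ev p x + x * d := by
  induction p with
  | nil =>
    intro n x d h
    have : d = 0 := h.unique (by simpa [ev] using hasDerivAt_const x (0 : ℝ))
    simp [dern, ev, this]
  | cons a p ih =>
    intro n x d h
    have hd : DifferentiableAt ℝ (fun y : ℝ => ev p y) x := by
      clear ih h
      induction p with
      | nil => simp [ev]
      | cons b p ih => simp only [ev]; fun_prop
    have h' : HasDerivAt (fun y : ℝ => ev (a :: p) y)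
        (1 * ev p x + x * deriv (fun y : ℝ => ev p y) x) x := by
      simp only [ev]
      exact ((hasDerivAt_id x).mul hd.hasDerivAt).const_add (a : ℝ)
    have e := h.unique h'
    simp only [dern, ev]
    rw [ih (n + 1) x _ hd.hasDerivAt, e]
    push_cast; ring

theorem ev_diff (p : List ℤ) (x : ℝ) : DifferentiableAt ℝ (fun y : ℝ => ev p y) x := by
  induction p with
  | nil => simp [ev]
  | cons b p ih => simp only [ev]; fun_prop

theorem ev_hasDerivAt (p : List ℤ) (x : ℝ) :
    HasDerivAt (fun y : ℝ => ev p y) (ev (der p) x) x := by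
  cases p with
  | nil => simpa [ev, der, dern] using hasDerivAt_const x (0 : ℝ)
  | cons a p =>
    have hd := (ev_diff p x).hasDerivAt
    have h' : HasDerivAt (fun y : ℝ => ev (a :: p) y)
        (1 * ev p x + x * deriv (fun y : ℝ => ev p y) x) x := by
      simp only [ev]
      exact ((hasDerivAt_id x).mul hd).const_add (a : ℝ)
    simp only [der, List.tail_cons]
    rw [ev_dern p 1 x _ hd]
    simpa using h'

theorem natAbs_cast (a : ℤ) : ((a.natAbs : ℕ) : ℝ) = |(a : ℝ)| := by
  rw [Nat.cast_natAbs, Int.cast_abs]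

theorem nev_bound (p : List ℤ) {b : ℕ} {x : ℝ} (hx : |x| ≤ b) : |ev p x| ≤ nev b p := by
  induction p with
  | nil => simp [ev, nev]
  | cons a p ih =>
    have e : ((nev b (a :: p) : ℕ) : ℝ) = |(a : ℝ)| + b * nev b p := by
      show ((a.natAbs + b * nev b p : ℕ) : ℝ) = _
      rw [← natAbs_cast]; push_cast; ring
    rw [e]
    simp only [ev]
    refine (abs_add_le _ _).trans ?_
    rw [abs_mul]
    gcongr

theorem lipb_bound (p : List ℤ) {b : ℕ} {x y : ℝ} (hx : |x| ≤ b) (hy : |y| ≤ b) :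
    |ev p x - ev p y| ≤ lipb b p * |x - y| := by
  induction p with
  | nil => simp [ev, lipb]
  | cons a p ih =>
    have e : ((lipb b (a :: p) : ℕ) : ℝ) = nev b p + b * lipb b p := by
      show ((nev b p + b * lipb b p : ℕ) : ℝ) = _
      push_cast; rfl
    rw [e]
    simp only [ev]
    have e2 : (a : ℝ) + x * ev p x - (a + y * ev p y) =
        (x - y) * ev p x + y * (ev p x - ev p y) := by ring
    rw [e2]
    refine (abs_add_le _ _).trans ?_
    rw [abs_mul, abs_mul]
    have h1 := mul_le_mul_of_nonneg_left (nev_bound p hx) (abs_nonneg (x - y))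
    have h2 := mul_le_mul hy ih (abs_nonneg _) (Nat.cast_nonneg b)
    nlinarith

theorem nev_cons (b : ℕ) (a : ℤ) (p : List ℤ) : nev b (a :: p) = a.natAbs + b * nev b p := rfl

theorem nev_padd (p q : List ℤ) : nev 1 (padd p q) ≤ nev 1 p + nev 1 q := by
  induction p generalizing q with
  | nil => simp [padd, nev]
  | cons a p ih =>
    cases q with
    | nil => simp [padd, nev]
    | cons b q =>
      simp only [padd, nev_cons, one_mul]
      have := ih q
      have := Int.natAbs_add_le a b
      omega

theorem nev_smul (c : ℤ) (p : List ℤ) : nev 1 (smul c p) = c.natAbs * nev 1 p := by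
  induction p with
  | nil => simp [smul, nev]
  | cons a p ih => simp only [smul, nev_cons, ih, Int.natAbs_mul]; ring

theorem nev_pmul (p q : List ℤ) : nev 1 (pmul p q) ≤ nev 1 p * nev 1 q := by
  induction p with
  | nil => simp [pmul, nev]
  | cons a p ih =>
    simp only [pmul]
    refine (nev_padd _ _).trans ?_
    simp only [nev_smul, nev_cons, one_mul, Int.natAbs_zero, zero_add, add_mul]
    omega

theorem nev_pcomp (c d : ℤ) (p : List ℤ) :
    nev 1 (pcomp c d p) ≤ nev (c.natAbs + d.natAbs) p := by
  induction p with
  | nil => simp [pcomp, nev]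
  | cons a p ih =>
    simp only [pcomp]
    refine (nev_padd _ _).trans ?_
    simp only [nev_smul, nev_cons, one_mul]
    have := Nat.mul_le_mul_left (c.natAbs + d.natAbs) ih
    linarith

/-- Kronecker substitution: a polynomial with small coefficients vanishing at a large integer
is zero. -/
theorem kron (B : ℕ) (d : List ℤ) (hs : nev 1 d < B) (h0 : ev d (B : ℤ) = 0) (x : ℝ) :
    ev d x = 0 := by
  induction d with
  | nil => rfl
  | cons a p ih =>
    simp only [nev_cons, one_mul] at hs
    simp only [ev, Int.cast_id] at h0
    have hdvd : (B : ℤ) ∣ a := ⟨-ev p (B : ℤ), by linarith⟩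
    have ha : a = 0 := by
      apply Int.eq_zero_of_abs_lt_dvd hdvd
      rw [Int.abs_eq_natAbs]; exact_mod_cast (by omega : a.natAbs < B)
    subst ha
    have hB : (B : ℤ) ≠ 0 := by
      intro h; norm_cast at h; omega
    have : ev p (B : ℤ) = 0 := by
      rw [zero_add] at h0
      exact (mul_eq_zero.mp h0).resolve_left hB
    simp [ev, ih (by omega) this]

end lists

/-! ### The transfer operator -/

/-- The transfer operator of the Bolyai–Rényi map. -/
noncomputable def Lop (g : ℝ → ℝ) (x : ℝ) : ℝ :=
  ∑ k ∈ Finset.range 3, 1 / (2 * √(x + 1 + k)) * g (√(x + 1 + k) - 1)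

def LipOn (M : ℝ) (g : ℝ → ℝ) : Prop :=
  ∀ x ∈ Set.Icc (0 : ℝ) 1, ∀ y ∈ Set.Icc (0 : ℝ) 1, |g x - g y| ≤ M * |x - y|

theorem LipOn.continuousOn {M : ℝ} {g : ℝ → ℝ} (h : LipOn M g) :
    ContinuousOn g (Set.Icc 0 1) := by
  have : LipschitzOnWith (Real.toNNReal M) g (Set.Icc 0 1) := by
    refine LipschitzOnWith.of_dist_le_mul fun x hx y hy => ?_
    rw [Real.dist_eq, Real.dist_eq]
    refine (h x hx y hy).trans ?_
    gcongr
    exact Real.le_coe_toNNReal M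
  exact this.continuousOn

theorem T_measurable : Measurable T := by
  unfold T
  refine Measurable.ite measurableSet_Iio (by fun_prop) ?_
  exact Measurable.ite measurableSet_Iio (by fun_prop) (by fun_prop)

theorem intg {φ g : ℝ → ℝ} {C : ℝ} (hφ : Measurable φ) (hC : ∀ x, |φ x| ≤ C)
    (hg : IntegrableOn g (Set.Ico 0 1)) :
    IntegrableOn (fun x => φ x * g x) (Set.Ico 0 1) :=
  Integrable.bdd_mul (c := C) hg hφ.aestronglyMeasurable (ae_of_all _ hC)

theorem intC {g : ℝ → ℝ} (hg : ContinuousOn g (Set.Icc 0 1)) :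
    IntegrableOn g (Set.Ico 0 1) :=
  hg.integrableOn_Icc.mono_set Set.Ico_subset_Icc_self

theorem psi_mem {x : ℝ} (hx : x ∈ Set.Icc (0 : ℝ) 1) {k : ℕ} (hk : k < 3) :
    √(x + 1 + k) - 1 ∈ Set.Icc (0 : ℝ) 1 := by
  have hk' : (k : ℝ) ≤ 2 := by exact_mod_cast Nat.lt_succ_iff.mp hk
  have hk0 : (0 : ℝ) ≤ k := by positivity
  have h1 : (1 : ℝ) ≤ √(x + 1 + k) := Real.one_le_sqrt.mpr (by linarith [hx.1])
  have h2 : √(x + 1 + k) ≤ 2 := by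
    rw [Real.sqrt_le_left (by norm_num)]; linarith [hx.2]
  constructor <;> linarith

theorem Lop_continuousOn {g : ℝ → ℝ} (hg : ContinuousOn g (Set.Icc 0 1)) :
    ContinuousOn (Lop g) (Set.Icc 0 1) := by
  unfold Lop
  refine continuousOn_finsetSum _ fun k hk => ?_
  refine ContinuousOn.mul ?_ ?_
  · refine ContinuousOn.div continuousOn_const (by fun_prop) ?_
    intro x hx
    have : 0 < x + 1 + k := by have := hx.1; positivity
    positivity
  · refine hg.comp (by fun_prop) ?_
    intro x hx
    exact psi_mem hx (Finset.mem_range.mp hk)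

theorem T_psi {x : ℝ} (hx : x ∈ Set.Ico (0 : ℝ) 1) {k : ℕ} (hk : k < 3) :
    T (√(x + 1 + k) - 1) = x := by
  have hx0 := hx.1
  have hx1 := hx.2
  interval_cases k
  · have h : √(x + 1 + (0 : ℕ)) < √2 := Real.sqrt_lt_sqrt (by push_cast; linarith) (by push_cast; linarith)
    have hs := Real.sq_sqrt (show 0 ≤ x + 1 + (0 : ℕ) by push_cast; linarith)
    unfold T
    rw [if_pos (by linarith)]
    push_cast at *
    linarith
  · have h : √(x + 1 + (1 : ℕ)) < √3 := Real.sqrt_lt_sqrt (by push_cast; linarith) (by push_cast; linarith)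
    have h' : √2 ≤ √(x + 1 + (1 : ℕ)) := Real.sqrt_le_sqrt (by push_cast; linarith)
    have hs := Real.sq_sqrt (show 0 ≤ x + 1 + (1 : ℕ) by push_cast; linarith)
    unfold T
    rw [if_neg (by linarith), if_pos (by linarith)]
    push_cast at *
    linarith
  · have h' : √3 ≤ √(x + 1 + (2 : ℕ)) := Real.sqrt_le_sqrt (by push_cast; linarith)
    have h2 : √2 ≤ √3 := Real.sqrt_le_sqrt (by norm_num)
    have hs := Real.sq_sqrt (show 0 ≤ x + 1 + (2 : ℕ) by push_cast; linarith)
    unfold T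
    rw [if_neg (by linarith), if_neg (by linarith)]
    push_cast at *
    linarith

theorem psi_image (k : ℕ) :
    (fun x : ℝ => √(x + 1 + k) - 1) '' Set.Ico 0 1 = Set.Ico (√(1 + k) - 1) (√(2 + k) - 1) := by
  ext y
  constructor
  · rintro ⟨x, hx, rfl⟩
    have hx0 := hx.1
    have hx1 := hx.2
    have hk0 : (0 : ℝ) ≤ k := by positivity
    constructor
    · have := Real.sqrt_le_sqrt (show 1 + (k : ℝ) ≤ x + 1 + k by linarith)
      simpa using this
    · have := Real.sqrt_lt_sqrt (show 0 ≤ x + 1 + (k : ℝ) by linarith)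
        (show x + 1 + (k : ℝ) < 2 + k by linarith)
      simpa using this
  · rintro ⟨h1, h2⟩
    have hk0 : (0 : ℝ) ≤ k := by positivity
    have hy : 0 ≤ y + 1 := by have := Real.sqrt_nonneg (1 + (k : ℝ)); linarith
    refine ⟨(y + 1) ^ 2 - 1 - k, ⟨?_, ?_⟩, ?_⟩
    · have := (Real.sqrt_le_left hy).mp (show √(1 + (k : ℝ)) ≤ y + 1 by linarith)
      linarith
    · have := (Real.lt_sqrt hy).mp (show y + 1 < √(2 + (k : ℝ)) by linarith)
      linarith
    · have : (y + 1) ^ 2 - 1 - k + 1 + k = (y + 1) ^ 2 := by ring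
      simp only [this, Real.sqrt_sq hy]
      ring

theorem branch_integral (F : ℝ → ℝ) (k : ℕ) :
    ∫ x in Set.Ico (√(1 + k) - 1) (√(2 + k) - 1), F x =
      ∫ x in Set.Ico (0 : ℝ) 1, 1 / (2 * √(x + 1 + k)) * F (√(x + 1 + k) - 1) := by
  rw [← psi_image k]
  rw [integral_image_eq_integral_abs_deriv_smul (f' := fun x => 1 / (2 * √(x + 1 + k)))
    measurableSet_Ico]
  · refine setIntegral_congr_fun measurableSet_Ico fun x hx => ?_
    have : 0 ≤ 1 / (2 * √(x + 1 + k)) := by positivity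
    simp only [abs_of_nonneg this, smul_eq_mul]
  · intro x hx
    have hx0 := hx.1
    have hpos : x + 1 + (k : ℝ) ≠ 0 := by positivity
    have h1 : HasDerivAt (fun x : ℝ => x + 1 + k) 1 x := by
      simpa using ((hasDerivAt_id x).add_const (1 : ℝ)).add_const (k : ℝ)
    exact ((h1.sqrt hpos).sub_const 1).hasDerivWithinAt
  · intro x hx y hy hxy
    have hx0 := hx.1
    have hy0 := hy.1
    have hk0 : (0 : ℝ) ≤ k := by positivity
    have : √(x + 1 + (k : ℝ)) = √(y + 1 + k) := by simpa using hxy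
    have := (Real.sqrt_inj (by positivity) (by positivity)).mp this
    linarith

theorem duality {φ g : ℝ → ℝ} {C : ℝ} (hφ : Measurable φ) (hC : ∀ x, |φ x| ≤ C)
    (hg : ContinuousOn g (Set.Icc 0 1)) :
    ∫ x in Set.Ico (0 : ℝ) 1, φ (T x) * g x = ∫ x in Set.Ico (0 : ℝ) 1, φ x * Lop g x := by
  have hF : IntegrableOn (fun x => φ (T x) * g x) (Set.Ico 0 1) :=
    intg (hφ.comp T_measurable) (fun x => hC _) (intC hg)
  have s1 : (1 : ℝ) ≤ √2 := Real.one_le_sqrt.mpr (by norm_num)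
  have s2 : √2 ≤ √3 := Real.sqrt_le_sqrt (by norm_num)
  have s3 : √3 ≤ 2 := by rw [Real.sqrt_le_left (by norm_num)]; norm_num
  have u1 : Set.Ico (0 : ℝ) 1 =
      Set.Ico 0 (√2 - 1) ∪ (Set.Ico (√2 - 1) (√3 - 1) ∪ Set.Ico (√3 - 1) 1) := by
    rw [Set.Ico_union_Ico_eq_Ico (by linarith) (by linarith),
      Set.Ico_union_Ico_eq_Ico (by linarith) (by linarith)]
  have q4 : √(2 + 2 : ℝ) = 2 := by
    rw [show (2 + 2 : ℝ) = 2 ^ 2 by norm_num, Real.sqrt_sq (by norm_num)]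
  have hL : ∀ k ∈ Finset.range 3, IntegrableOn
      (fun x => φ x * (1 / (2 * √(x + 1 + (k : ℕ))) * g (√(x + 1 + k) - 1))) (Set.Ico 0 1) := by
    intro k hk
    refine intg hφ hC (intC ?_)
    refine ContinuousOn.mul ?_ ?_
    · refine ContinuousOn.div continuousOn_const (by fun_prop) ?_
      intro x hx
      have : 0 < x + 1 + k := by have := hx.1; positivity
      positivity
    · refine hg.comp (by fun_prop) ?_
      intro x hx
      exact psi_mem hx (Finset.mem_range.mp hk)
  have hR : ∫ x in Set.Ico (0 : ℝ) 1, φ x * Lop g x = ∑ k ∈ Finset.range 3,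
      ∫ x in Set.Ico (0 : ℝ) 1, φ x * (1 / (2 * √(x + 1 + (k : ℕ))) * g (√(x + 1 + k) - 1)) := by
    rw [← integral_finsetSum _ hL]
    refine integral_congr_ae (ae_of_all _ fun x => ?_)
    simp only [Lop, Finset.mul_sum]
  have hB : ∀ k ∈ Finset.range 3,
      ∫ x in Set.Ico (√(1 + (k : ℕ)) - 1) (√(2 + k) - 1), φ (T x) * g x =
      ∫ x in Set.Ico (0 : ℝ) 1, φ x * (1 / (2 * √(x + 1 + (k : ℕ))) * g (√(x + 1 + k) - 1)) := by
    intro k hk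
    rw [branch_integral]
    refine setIntegral_congr_fun measurableSet_Ico fun x hx => ?_
    simp only [T_psi hx (Finset.mem_range.mp hk)]
    ring
  rw [hR, ← Finset.sum_congr rfl hB]
  simp only [Finset.sum_range_succ, Finset.sum_range_zero, zero_add]
  norm_num [q4]
  have d1 : Disjoint (Set.Ico (√2 - 1) (√3 - 1)) (Set.Ico (√3 - 1) 1) := by
    rw [Set.disjoint_left]; rintro x ⟨_, h⟩ ⟨h', _⟩; linarith
  have d2 : Disjoint (Set.Ico 0 (√2 - 1))
      (Set.Ico (√2 - 1) (√3 - 1) ∪ Set.Ico (√3 - 1) 1) := by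
    rw [Set.disjoint_left]
    rintro x ⟨_, h⟩ (⟨h', _⟩ | ⟨h', _⟩) <;> linarith
  rw [u1, setIntegral_union d2 (by measurability), setIntegral_union d1 (by measurability)]
  · ring
  all_goals refine hF.mono_set ?_
  all_goals rw [u1]; intro x hx; simp only [Set.mem_union] at hx ⊢; tauto

theorem sup_of_mean_zero {g : ℝ → ℝ} {M : ℝ} (hM : 0 ≤ M) (hg : LipOn M g)
    (h0 : ∫ x in Set.Ico (0 : ℝ) 1, g x = 0) {x : ℝ} (hx : x ∈ Set.Icc (0 : ℝ) 1) :
    |g x| ≤ M := by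
  have e : ∫ t in Set.Ico (0 : ℝ) 1, (g x - g t) = g x := by
    rw [integral_sub (by simp) (intC hg.continuousOn), h0]
    simp
  have b : ‖∫ t in Set.Ico (0 : ℝ) 1, (g x - g t)‖ ≤ M * volume.real (Set.Ico (0 : ℝ) 1) := by
    refine norm_setIntegral_le_of_norm_le_const (by simp) fun t ht => ?_
    have ht' := Set.Ico_subset_Icc_self ht
    refine (hg x hx t ht').trans ?_
    have : |x - t| ≤ 1 := by
      rw [abs_le]; constructor <;> linarith [hx.1, hx.2, ht'.1, ht'.2]
    nlinarith
  rw [e] at b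
  simpa using b

theorem branch_lip {a b c x y M G1 G2 : ℝ} (hc : 1 ≤ c) (ha0 : 0 ≤ a) (hb0 : 0 ≤ b)
    (ha : a ^ 2 = x + c) (hb : b ^ 2 = y + c) (hx : 0 ≤ x) (hy : 0 ≤ y) (hM : 0 ≤ M)
    (h1 : |G1| ≤ M) (h2 : |G1 - G2| ≤ M * |a - b|) :
    |1 / (2 * a) * G1 - 1 / (2 * b) * G2| ≤ 1 / (2 * c) * (M * |x - y|) := by
  have ha1 : 1 ≤ a := by nlinarith
  have hb1 : 1 ≤ b := by nlinarith
  have hab : c ≤ a * b := by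
    have : c ^ 2 ≤ (a * b) ^ 2 := by
      rw [mul_pow, ha, hb]; nlinarith
    exact le_of_sq_le_sq this (by positivity)
  have hxy : |x - y| = |a - b| * (a + b) := by
    rw [show x - y = (a - b) * (a + b) by linear_combination hb - ha, abs_mul,
      abs_of_nonneg (by linarith : 0 ≤ a + b)]
  have hkey : 1 / (2 * a) * G1 - 1 / (2 * b) * G2 =
      (b - a) / (2 * (a * b)) * G1 + 1 / (2 * b) * (G1 - G2) := by
    field_simp; ring
  rw [hkey, hxy]
  have t1 : |(b - a) / (2 * (a * b)) * G1| ≤ |a - b| / (2 * (a * b)) * M := by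
    rw [abs_mul, abs_div, abs_sub_comm b a, abs_of_pos (by positivity : 0 < 2 * (a * b))]
    gcongr
  have t2 : |1 / (2 * b) * (G1 - G2)| ≤ 1 / (2 * b) * (M * |a - b|) := by
    rw [abs_mul, abs_of_pos (by positivity : 0 < 1 / (2 * b))]
    gcongr
  refine (abs_add_le _ _).trans ((add_le_add t1 t2).trans ?_)
  have e1 : |a - b| / (2 * (a * b)) * M + 1 / (2 * b) * (M * |a - b|) =
      (M * |a - b|) * ((1 + a) / (2 * (a * b))) := by field_simp
  have e2 : 1 / (2 * c) * (M * (|a - b| * (a + b))) = (M * |a - b|) * ((a + b) / (2 * c)) := by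
    field_simp
  rw [e1, e2]
  refine mul_le_mul_of_nonneg_left ?_ (by positivity)
  rw [div_le_div_iff₀ (by positivity) (by positivity)]
  nlinarith [mul_le_mul hab (by linarith : 1 + a ≤ a + b) (by positivity) (by positivity)]

theorem contraction {g : ℝ → ℝ} {M : ℝ} (hM : 0 ≤ M) (hg : LipOn M g)
    (h0 : ∫ x in Set.Ico (0 : ℝ) 1, g x = 0) : LipOn (11 / 12 * M) (Lop g) := by
  intro x hx y hy
  unfold Lop
  rw [← Finset.sum_sub_distrib]
  refine (Finset.abs_sum_le_sum_abs _ _).trans ?_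
  have hb : ∀ k ∈ Finset.range 3,
      |1 / (2 * √(x + 1 + (k : ℕ))) * g (√(x + 1 + k) - 1) -
        1 / (2 * √(y + 1 + k)) * g (√(y + 1 + k) - 1)| ≤ 1 / (2 * (1 + k)) * (M * |x - y|) := by
    intro k hk
    have hk' := Finset.mem_range.mp hk
    have hk0 : (0 : ℝ) ≤ k := by positivity
    have hx0 := hx.1
    have hy0 := hy.1
    refine branch_lip (by linarith) (Real.sqrt_nonneg _) (Real.sqrt_nonneg _) ?_ ?_ hx.1 hy.1 hM
      (sup_of_mean_zero hM hg h0 (psi_mem hx hk')) ?_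
    · rw [Real.sq_sqrt (by positivity)]; ring
    · rw [Real.sq_sqrt (by positivity)]; ring
    · refine (hg _ (psi_mem hx hk') _ (psi_mem hy hk')).trans (le_of_eq ?_)
      congr 2; ring
  refine (Finset.sum_le_sum hb).trans (le_of_eq ?_)
  simp only [Finset.sum_range_succ, Finset.sum_range_zero]
  push_cast
  ring

theorem Lop_mean {g : ℝ → ℝ} (hg : ContinuousOn g (Set.Icc 0 1)) :
    ∫ x in Set.Ico (0 : ℝ) 1, Lop g x = ∫ x in Set.Ico (0 : ℝ) 1, g x := by
  have := duality (φ := fun _ => 1) (C := 1) measurable_const (by simp) hg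
  simpa using this.symm

theorem iterate_bound {φ : ℝ → ℝ} {C : ℝ} (hφ : Measurable φ) (hC : ∀ x, |φ x| ≤ C) (n : ℕ) :
    ∀ (g : ℝ → ℝ) (M : ℝ), 0 ≤ M → LipOn M g → ∫ x in Set.Ico (0 : ℝ) 1, g x = 0 →
    |∫ x in Set.Ico (0 : ℝ) 1, φ (T^[n] x) * g x| ≤ C * M * (11 / 12) ^ n := by
  have hC0 : 0 ≤ C := (abs_nonneg _).trans (hC 0)
  induction n with
  | zero =>
    intro g M hM hg h0
    have b : ‖∫ t in Set.Ico (0 : ℝ) 1, φ t * g t‖ ≤ (C * M) * volume.real (Set.Ico (0 : ℝ) 1) := by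
      refine norm_setIntegral_le_of_norm_le_const (by simp) fun t ht => ?_
      rw [norm_mul]
      exact mul_le_mul (hC t) (sup_of_mean_zero hM hg h0 (Set.Ico_subset_Icc_self ht))
        (norm_nonneg _) hC0
    simpa using b
  | succ n ih =>
    intro g M hM hg h0
    have e := duality (φ := fun x => φ (T^[n] x)) (hφ.comp (T_measurable.iterate n))
      (fun x => hC _) hg.continuousOn
    simp only [Function.iterate_succ_apply]
    rw [e]
    refine (ih (Lop g) (11 / 12 * M) (by positivity) (contraction hM hg h0)
      (by rw [Lop_mean hg.continuousOn, h0])).trans (le_of_eq ?_)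
    rw [pow_succ]; ring

theorem residual_bound {φ h : ℝ → ℝ} {C ε : ℝ} (hφ : Measurable φ) (hC : ∀ x, |φ x| ≤ C)
    (hh : ContinuousOn h (Set.Icc 0 1)) (hε : 0 ≤ ε) (hR : LipOn ε (fun x => Lop h x - h x))
    (n : ℕ) :
    |(∫ x in Set.Ico (0 : ℝ) 1, φ (T^[n] x) * h x) - ∫ x in Set.Ico (0 : ℝ) 1, φ x * h x| ≤
      12 * C * ε * (1 - (11 / 12) ^ n) := by
  induction n with
  | zero => simp
  | succ n ih =>
    have e := duality (φ := fun x => φ (T^[n] x)) (hφ.comp (T_measurable.iterate n))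
      (fun x => hC _) hh
    simp only [Function.iterate_succ_apply]
    rw [e]
    have i1 : IntegrableOn (fun x => φ (T^[n] x) * h x) (Set.Ico 0 1) :=
      intg (hφ.comp (T_measurable.iterate n)) (fun x => hC _) (intC hh)
    have i2 : IntegrableOn (fun x => φ (T^[n] x) * Lop h x) (Set.Ico 0 1) :=
      intg (hφ.comp (T_measurable.iterate n)) (fun x => hC _) (intC (Lop_continuousOn hh))
    have b := iterate_bound hφ hC n _ ε hε hR (by
      rw [integral_sub (intC (Lop_continuousOn hh)) (intC hh), Lop_mean hh, sub_self])
    have e2 : ∫ x in Set.Ico (0 : ℝ) 1, φ (T^[n] x) * (Lop h x - h x) =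
        (∫ x in Set.Ico (0 : ℝ) 1, φ (T^[n] x) * Lop h x) -
          ∫ x in Set.Ico (0 : ℝ) 1, φ (T^[n] x) * h x := by
      rw [← integral_sub i2 i1]
      simp only [mul_sub]
    rw [e2] at b
    rw [abs_le] at *
    rw [pow_succ]
    constructor <;> linarith [b.1, b.2, ih.1, ih.2]

/-! ### From the residual to an arbitrary absolutely continuous invariant measure -/

theorem poly_lip (p : Polynomial ℝ) : ∃ M, 0 ≤ M ∧ LipOn M (fun x => p.eval x) := by
  have hd : ContinuousOn (fun x => p.derivative.eval x) (Set.Icc (0 : ℝ) 1) :=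
    p.derivative.continuous.continuousOn
  obtain ⟨M, hM⟩ := isCompact_Icc.exists_bound_of_continuousOn hd
  refine ⟨M, (norm_nonneg _).trans (hM 0 (by simp)), fun x hx y hy => ?_⟩
  have := Convex.norm_image_sub_le_of_norm_hasDerivWithin_le (f := fun x => p.eval x)
    (fun z _ => (p.hasDerivAt z).hasDerivWithinAt) hM (convex_Icc (0 : ℝ) 1) hy hx
  simpa using this

/-- Approximation of an integrable function on `[0,1)` by polynomials. -/
theorem approx_poly {f : ℝ → ℝ} (hf : Integrable f) {δ : ℝ} (hδ : 0 < δ) :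
    ∃ p : Polynomial ℝ, ∫ x in Set.Ico (0 : ℝ) 1, |f x - p.eval x| ≤ δ := by
  obtain ⟨g, -, hg, hgc, hgi⟩ :=
    hf.exists_hasCompactSupport_integral_sub_le (half_pos hδ)
  obtain ⟨p, hp⟩ := exists_polynomial_near_of_continuousOn 0 1 g hgc.continuousOn (δ / 2)
    (half_pos hδ)
  refine ⟨p, ?_⟩
  have i1 : IntegrableOn (fun x => |f x - g x|) (Set.Ico (0 : ℝ) 1) :=
    ((hf.sub hgi).norm).integrableOn
  have i2 : IntegrableOn (fun x => |f x - p.eval x|) (Set.Ico (0 : ℝ) 1) :=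
    (hf.integrableOn.sub (intC p.continuous.continuousOn)).norm
  have i3 : IntegrableOn (fun _ : ℝ => δ / 2) (Set.Ico (0 : ℝ) 1) := by simp
  calc ∫ x in Set.Ico (0 : ℝ) 1, |f x - p.eval x|
      ≤ ∫ x in Set.Ico (0 : ℝ) 1, (|f x - g x| + δ / 2) := by
        refine setIntegral_mono_on i2 (i1.add i3) measurableSet_Ico fun x hx => ?_
        have h1 := hp x (Set.Ico_subset_Icc_self hx)
        have h2 := abs_sub_le (f x) (g x) (p.eval x)
        rw [abs_sub_comm] at h1
        linarith
    _ = (∫ x in Set.Ico (0 : ℝ) 1, |f x - g x|) + δ / 2 := by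
        rw [integral_add i1 i3]; simp
    _ ≤ δ / 2 + δ / 2 := by
        gcongr
        refine le_trans ?_ hg
        exact setIntegral_le_integral ((hf.sub hgi).norm) (ae_of_all _ fun x => abs_nonneg _)
    _ = δ := by ring

theorem abstract_bound (μ : Measure ℝ) [IsProbabilityMeasure μ]
    (hsupp : μ (Set.Ico (0 : ℝ) 1)ᶜ = 0)
    (hinv : ∀ A : Set ℝ, MeasurableSet A → μ (T ⁻¹' A) = μ A)
    (hac : μ ≪ volume) {φ h : ℝ → ℝ} {C ε M : ℝ} (hφ : Measurable φ) (hC : ∀ x, |φ x| ≤ C)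
    (hM : 0 ≤ M) (hh : LipOn M h) (h1 : ∫ x in Set.Ico (0 : ℝ) 1, h x = 1)
    (hε : 0 ≤ ε) (hR : LipOn ε (fun x => Lop h x - h x)) :
    |(∫ x, φ x ∂μ) - ∫ x in Set.Ico (0 : ℝ) 1, φ x * h x| ≤ 12 * C * ε := by
  have hC0 : 0 ≤ C := (abs_nonneg _).trans (hC 0)
  set f : ℝ → ℝ := fun x => (μ.rnDeriv volume x).toReal with hf
  have hfi : Integrable f := Measure.integrable_toReal_rnDeriv
  have hmp : MeasurePreserving T μ μ := ⟨T_measurable, by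
    ext A hA; rw [Measure.map_apply T_measurable hA, hinv A hA]⟩
  have hrestr : μ.restrict (Set.Ico 0 1) = μ := by
    apply Measure.restrict_eq_self_of_ae_mem
    rw [ae_iff]; exact hsupp
  -- integrals against μ
  have hrepr : ∀ ψ : ℝ → ℝ, ∫ x, ψ x ∂μ = ∫ x in Set.Ico (0 : ℝ) 1, ψ x * f x := by
    intro ψ
    have := setIntegral_rnDeriv_smul (f := ψ) hac (measurableSet_Ico (a := (0 : ℝ)) (b := 1))
    rw [hrestr] at this
    rw [← this]
    simp only [hf, smul_eq_mul, mul_comm]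
  have hinvn : ∀ n, ∫ x, φ (T^[n] x) ∂μ = ∫ x, φ x ∂μ := by
    intro n
    have hn := hmp.iterate n
    rw [← integral_map (φ := T^[n]) hn.measurable.aemeasurable hφ.aestronglyMeasurable, hn.map_eq]
  have hf1 : ∫ x in Set.Ico (0 : ℝ) 1, f x = 1 := by
    have := hrepr (fun _ => 1)
    simpa using this.symm
  have hhc := hh.continuousOn
  refine le_of_forall_pos_le_add fun δ' hδ' => ?_
  -- choose δ
  obtain ⟨K, hK⟩ : ∃ K, ∀ n, |∫ x in Set.Ico (0 : ℝ) 1, φ (T^[n] x) * h x| ≤ K := by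
    refine ⟨|∫ x in Set.Ico (0 : ℝ) 1, φ x * h x| + 12 * C * ε, fun n => ?_⟩
    have b := residual_bound hφ hC hhc hε hR n
    have p : (0 : ℝ) ≤ (11 / 12) ^ n := by positivity
    have q : 0 ≤ 12 * C * ε := by positivity
    have := abs_sub_abs_le_abs_sub (∫ x in Set.Ico (0 : ℝ) 1, φ (T^[n] x) * h x)
      (∫ x in Set.Ico (0 : ℝ) 1, φ x * h x)
    nlinarith
  have hK0 : 0 ≤ K := (abs_nonneg _).trans (hK 0)
  set δ := δ' / (2 * (C + K + 1)) with hδdef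
  have hδ : 0 < δ := by positivity
  obtain ⟨p, hp⟩ := approx_poly hfi hδ
  obtain ⟨Mp, hMp, hpl⟩ := poly_lip p
  have ip : IntegrableOn (fun x => p.eval x) (Set.Ico (0 : ℝ) 1) := intC hpl.continuousOn
  have ifd : IntegrableOn f (Set.Ico (0 : ℝ) 1) := hfi.integrableOn
  set m := ∫ x in Set.Ico (0 : ℝ) 1, p.eval x with hm
  have hm1 : |1 - m| ≤ δ := by
    rw [← hf1, hm, ← integral_sub ifd ip]
    exact (abs_integral_le_integral_abs).trans hp
  -- the mean zero function p - m h
  have hgl : LipOn (Mp + |m| * M) (fun x => p.eval x - m * h x) := by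
    intro x hx y hy
    have a := hpl x hx y hy
    have b := hh x hx y hy
    have e : p.eval x - m * h x - (p.eval y - m * h y) =
      (p.eval x - p.eval y) - m * (h x - h y) := by ring
    rw [e]
    refine (abs_sub _ _).trans ?_
    rw [abs_mul]
    nlinarith [mul_le_mul_of_nonneg_left b (abs_nonneg m)]
  have hg0 : ∫ x in Set.Ico (0 : ℝ) 1, (p.eval x - m * h x) = 0 := by
    rw [integral_sub ip ((intC hhc).const_mul m), integral_const_mul, h1]
    simp [hm]
  have hMg : 0 ≤ Mp + |m| * M := by positivity
  have key : ∀ n : ℕ, |(∫ x, φ x ∂μ) - ∫ x in Set.Ico (0 : ℝ) 1, φ x * h x| ≤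
      12 * C * ε + (C + K) * δ + C * (Mp + |m| * M) * (11 / 12) ^ n := by
    intro n
    have mφ : Measurable (fun x => φ (T^[n] x)) := hφ.comp (T_measurable.iterate n)
    have bφ : ∀ x, |φ (T^[n] x)| ≤ C := fun x => hC _
    have j1 := intg mφ bφ ifd
    have j2 := intg mφ bφ ip
    have j3 := intg mφ bφ (intC hhc)
    have a1 : |(∫ x in Set.Ico (0 : ℝ) 1, φ (T^[n] x) * f x) -
        ∫ x in Set.Ico (0 : ℝ) 1, φ (T^[n] x) * p.eval x| ≤ C * δ := by
      rw [← integral_sub j1 j2]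
      refine (abs_integral_le_integral_abs).trans ?_
      have i2 : IntegrableOn (fun x => |f x - p.eval x|) (Set.Ico (0 : ℝ) 1) := (ifd.sub ip).norm
      calc _ ≤ ∫ x in Set.Ico (0 : ℝ) 1, C * |f x - p.eval x| := by
            refine setIntegral_mono_on (j1.sub j2).norm (i2.const_mul C) measurableSet_Ico
              fun x _ => ?_
            rw [← mul_sub, abs_mul]
            exact mul_le_mul_of_nonneg_right (bφ x) (abs_nonneg _)
        _ ≤ C * δ := by
            rw [integral_const_mul]
            exact mul_le_mul_of_nonneg_left hp hC0
    have a2 := iterate_bound hφ hC n _ _ hMg hgl hg0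
    have e2 : ∫ x in Set.Ico (0 : ℝ) 1, φ (T^[n] x) * (p.eval x - m * h x) =
        (∫ x in Set.Ico (0 : ℝ) 1, φ (T^[n] x) * p.eval x) -
          m * ∫ x in Set.Ico (0 : ℝ) 1, φ (T^[n] x) * h x := by
      rw [← integral_const_mul, ← integral_sub j2 (j3.const_mul m)]
      refine integral_congr_ae (ae_of_all _ fun x => ?_)
      simp only; ring
    rw [e2] at a2
    have a3 := residual_bound hφ hC hhc hε hR n
    have q : 0 ≤ 12 * C * ε := by positivity
    have a3' : 12 * C * ε * (1 - (11 / 12) ^ n) ≤ 12 * C * ε := by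
      have : (0 : ℝ) ≤ (11 / 12) ^ n := by positivity
      nlinarith
    have a4 : |(1 - m) * ∫ x in Set.Ico (0 : ℝ) 1, φ (T^[n] x) * h x| ≤ δ * K := by
      rw [abs_mul]
      exact mul_le_mul hm1 (hK n) (abs_nonneg _) hδ.le
    have e0 : ∫ x, φ x ∂μ = ∫ x in Set.Ico (0 : ℝ) 1, φ (T^[n] x) * f x := by
      rw [← hinvn n, hrepr (fun x => φ (T^[n] x))]
    rw [e0]
    rw [abs_le] at *
    constructor <;> linarith [a1.1, a1.2, a2.1, a2.2, a3.1, a3.2, a4.1, a4.2]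
  have lim : Tendsto (fun n : ℕ => 12 * C * ε + (C + K) * δ +
      C * (Mp + |m| * M) * (11 / 12 : ℝ) ^ n) atTop
      (nhds (12 * C * ε + (C + K) * δ + C * (Mp + |m| * M) * 0)) := by
    refine Tendsto.const_add _ (Tendsto.const_mul _ ?_)
    exact tendsto_pow_atTop_nhds_zero_of_lt_one (by norm_num) (by norm_num)
  have fin := ge_of_tendsto' lim key
  refine fin.trans ?_
  have : (C + K) * δ ≤ δ' := by
    rw [hδdef, mul_div_assoc', div_le_iff₀ (by positivity)]
    nlinarith
  linarith

/-- The certificate: scaled coefficients of `S`; the density is the derivative of `w` times that of `S`. -/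
def cS : List ℤ := [
  0,
  218363632595155063510656186452850774859837649827944011512128741086933214810602951771050487389514113666236128714754163747030840823496043140,
  -940636492944994302344731079406148426174694801868451156411048430625463194773132658167638520141146085739516189301977064821500810097459303195,
  5428120499512630094696161911188521515683152616586766988058813265942782583178346782955995279003939127672402553678607988107588908016895303332,
  -30048616494290543565552673778885070664501164143228908543406542238216883647953821818267809529514431842252891186396241135693668568066071936621,
  151157818499693815865802920965871238607885645233679955720796146344546988392278352327647985076704996688817268981531936899948178061028841487107,
  -683981126213187460955293680048881216995794353616590771974645468073328801653362655968206007652810598189777614846228208702038918937494578528171,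
  2787795384332233449120254755100012398093376675736144066035990880393351496855884313137276370700662132150317893859749037522955842441588922920216,
  -10283592094380119911400562833696747585275026878239405869530347715499963232678811802685961955381723561043495168521020836004734066302153410298962,
  34523045155792471259244468282946875105374187409521667537220846558586214617799864436585905065254301820258070125731395385396105177072524662155398,
  -106054884506266584027207052602947203338968377982873655485518559517127935866362151449436216342838455631718710241165724567467639767375532204369546,
  299653880467313306575375204994614301808813693768931357627392580040870096624370721316091540946187532184391792615062443864363668611811013099514179,
  -782321953122717811197258723399244528998103780777912864805001213509812462478435500235174285981700940033751836631572916323927186465400319587931011,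
  1895119104564877982137315172615113874739174791859773912809806477195932132716651806144952721790877584813918007292456014107798366100898377472647803,
  -4275604075502055864071969776557109163776494552588195413578354481804706452431024595535285832382067338236403968608060015111419913875443920362260114,
  9014213624078187214138999828034384245009731633968893041993346948575382210638429996697685304975797123311477970501730465044773630841260083758783580,
  -17813161363517917470603675758307548370972475107436051530947936034424699244797868365986581856970278705445004123768335053021502999588355549108933972,
  33084302240099539307633616709361834291848701171458956459120360751966071570475484297357399316942938324516062838787843397627605752280699482980285017,
  -57895268041099989687867743372369226029801218370352422360662040504245945971784159735673329423737058116065704884321146613744522709815726190064306525,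
  95670365865977233266190416604676780272288052413604959157387290950257774695378491338825613673853644718580217219579391881676122244672572060025927716,
  -149592863053916160115363858052460035957977356375813802481784846842787583955845347555305678469751986279420593322695880938088849104056892704726514554,
  221744030752693244153324777406311557632863820115422936195843050165801714171682632178771571771940672414994848443210173821781170974120652409971580203,
  -312133684546619315680700304183186693928448972322570733334072988591080301517232183561759527123666443807739191759440592959146893560765635034498745528,
  417884208729224182466082843043384121655629452663148395568757586971655824434906090353464237285723105441833291132163475503148855978476987844684598918,
  -532871302199829395175416031386432457019984154300980447092044911433577700307980603082311080487888294014780748430757070985235639331193000554501443036,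
  648060046357174632829441013196575872982190568088424153559735022605622393840387211849738538466574406825525617661337668187155605275115511468080188627,
  -752603333856829791778924066478731743216530752134415991512308130962422464687765791925231551195875378054915032797826768202049909683737521092113005029,
  835538798969621740428679263634715240432122396770648116676692398718421871054328250587296511240718649423401993251949497620854212641589357897098808405,
  -887712267249948155878431448094052030174159887815285434387994541655670777263611303717002435099238699939741286612694497837264043161955457125934578659,
  903453124321426588182221977265035008503972802122007217414650215432220881020273660470627772063082753116679155732270102232780782044432396826835910242,
  -881575575123088029263745131266635898381429014894835461449616082760240567062757894632020258716284592627229873453790051571907837188655287150830035549,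
  825466173684998966767444814302108680921877063685968096181909477128200484051660509586025633455592881104770655216215631987287327346409853826858278964,
  -742275134174749665061918259184512807966033305660227814255562726658474577871805452592782241180388592342617892629269714236310718271666410233810458209,
  641465539654020260744888353912195287580388870167637147111998584925127441046771900772133394994499282507493929818736810740056413992038713061523692065,
  -533113883547463496669972884583982826489614355672581297293825310690334817383962168887924332762592436182575678888446513339427964642513549563502192615,
  426363975629006468261054528208902714511308401054315406452344685125119531736639971388978180859481525382293736480041460528305339870401570759194652371,
  -328331103409024445758852735360183717625680356462677634345913870797831024338943991518022273922754747133401780892306037365144915004930104111512984435,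
  243587249824143575548085616123340108806307266392894034150450909607987544749188084852587080846540750831635619933229339210242925132391456854226199604,
  -174193535018724896961277920571547404237679272235174456356733216881375576216234551627256603836644618995426752232829288884289956857560187996287093333,
  120130532501523335592342777939408107688063832849384930943044492021684990558435305738080211269226529442020443856394198691865315975843041108133333433,
  -79930678022064791483312041559837607036303767103861594425292024304513572243609760919324638734160561300734739312222349979235997016555014947254757286,
  51332673509920245420131991894579277397681714623295128436022936539674457926246181461611375059638936613671592445716535626971002847526672745859228109,
  -31831976655312005576101935328419238471580688625257605132470925446937631071418576195828513136623059280248265149475536199231595576556985172305436778,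
  19066890238286544373519494337640333041261487579854685686323613649156519357420432689236618603731142152585305068308352652430626372953023384269081051,
  -11035413755208265614681739460605172528543293254442475059058265236250037001910921223077357376290832203055384184916254470537680669600985436858339518,
  6173410340085591983365599566574251526462848061346258031783388142190980676324856917736140734458631270237334028589810992603031558534814333447630559,
  -3338985422003950415124869878499773711137767304648491819809986756465644059624987711689887122170278043631167355925816217650257047963066889131881132,
  1746514107443047566518739783430149628657479070456735777747323088435096056133321507812052857162116732783886361057225716666003586518369146927277698,
  -883698009390717705172374682575836427948926452719360835255503152565464753331428333062960522234201475718235313080785096938161646327602796836020218,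
  432620298204715164588035736973709044996498873814101079822919278282702219868744756762146632134890316294593771175336582342540612245512721204818171,
  -204960197618915684436212761278442508568637032372586850989021793186909204308641335626063580312773383606235640326674531272349052875630938660496264,
  93987873569732626367597820945905594003842453242646997593595024464468914810978100413520852992486106072770242373848813404943361635291339000965264,
  -41723977840132566981955856733176061058420990586267718847115366148819616934966541359829087025929701724471272192363581947443908281939264492691775,
  17933920754047734821069215335821176126778605276984693276262823281538262489243340972436905932728091783629261101335220332317999866359265967165607,
  -7464433435056725080882944220542501993059623670108522332113303605271612382362594127181341620179128244962198388432000065157126511643693555134455,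
  3008842333642029744520666534189065289793680093420275196420124700118713482560330235128500790934971110954731542747784663654186105783494671278442,
  -1174693502862185764759682260728836084636254869688898593703571204981129423795990068639863489787748848748132147908488300907892772247928878038692,
  444228707354152042211076475527352275693330132070370972556518727546265921744675891447318836665689034571256457836237000164019521160566835126340,
  -162731956586306673532970948152442534364792689783710667138542207498605866033487756005369102522407111683506253173749950159761563988817581680690,
  57748867159775322908682048720033805994456421655079317548023945116608865363897199881934553312002076278338753972072663844299213439436973816471,
  -19853256174945001863846798229250604402547364400084417542761959476474070010745569118637337379968469913656061619144050654204150382476396726787,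
  6612169901746877895241328458523004099171308569429495668446179420176553361480123025307774552631319264304659095072426659353656961147852577271,
  -2133436183381900337683924139244822297688848418112264023219477180289454527914140612246048849624650252697400123815005396330409212933083775897,
  666854675888422148653878415490435567176206375717977386020141381262481860099380865633053323046281687230569242317099579677202429550576292110,
  -201922258442651007014690575196772793870873284814982629011776139353134670848516559866674454558096186610690418952855774350475285194852035028,
  59226656037797126603029877928704150048455533637058176655153538249536414045912363115600757647012652383879163602355522855273036078659802156,
  -16826809454197730424963592819213857761935335425854467264109274488967422052513035871134115621491496449867180202847813410357156547350177906,
  4630226867928904091168598081834149492825061328226809758518014993453822565051369350471118599613115795164989273404320140986891407852964532,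
  -1233888251633805143857633400274553520425890060380045896586605223024702653267597841306526389187630395354667403736382992353242718388620941,
  318399372772145969887324528550225697736488660263815053577592851384697211232659585401414552743957579506692448290443465105527199852555093,
  -79548794737691808068080586172271750891567873130013411604376493691245342971477520840200263014514832985590522694348144542047056756894522,
  19239532505032749252563363166890986536192101526723872793014583374706933635148796003707436376376028310812792856920455013553666184885251,
  -4503824769608216819849615456169728934703814578836605604215383871725553868038440715237187089568895732732517957916071409684394493067102,
  1020264758154639215892267698984183354970074409927008342077556497082058299275575830269600815312320366616804445767213101391352813392671,
  -223613819888679339210938531905242758752806669221731675035844364768624533100036169781728764000280432417089242173180989005346428430315,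
  47406721499751923017574718549603365376334892132246369872882045018194981808368215202432804875165223496695342916861408861842012322051,
  -9719161740792434265992946575498305164793632495660556143298158565041637226949738344558160951337891854744064480950644826152626726237,
  1926406394828657999493988917527476843659957921294408908000460493524952500220219102904970424421593205576638247132684432724352429749,
  -369037025952037483768703026734487414247405638922839138972507846666206022602212849474381386266211622645347508727694141887863916293,
  68305748197896269048084745909215299213105876513771439723566424109510289990478778615168167322390529904145715938309005895227163745,
  -12211283514168051492890435247865857654690417613590870004598226400573307972201125548274083204403625563556317532378934018449831688,
  2107764753317313136716938698571068137658738452435442059847809135169186055157471577302550630578871806331222395439758217213099034,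
  -351129756560812832456040747903621807865212729018436571407305966470662827334424396121758675121567389283930516805560347628016543,
  56430371905851499853762615417491361799464604796597245817111395247460353457830521487163390760658581639233432672550437715484716,
  -8744993274592526128644312920885256119014209307668304420381001236899936862530548239240174829327258296125223404547549567017403,
  1306153982146107731951262967471289147008029899733303266100336209307263044493581279716779465150823289604509357117817605368280,
  -187927012184153256755121102242464774638142592953605510077570157681586957635900056085191240689483036931025997997144652256536,
  26031491030829967789247960756747860332068848643810285377356941536711254108229742398423002605450440329525664936587109357535,
  -3469454714977915324094580963002665481388588509576719850902520805029094551018969651750684034220491300382578175475468507729,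
  444625121189110755745580225828082164780804236794296730436281186385182536533949203940128963149609359103911776930767599424,
  -54751372597153849761753494953466790380645119969949621715126940273642795175176682016443572385786512274045058071313625618,
  6473506775714159975339386979831551150816458404863172375520624306600811773311183775366983027778353310704746138719478571,
  -734309076365793491051670203715949627481465638575077833548982873195221676062843728404308038991144242029044798754067950,
  79843137755261791938534142954106078468774117016675934178908417454238386042393621024673797422557119658045990627341133,
  -8314029594137790769181165529049185111557150276236601391035687710984708169693316031082759692030026515651172028508979,
  828256801464818970669907438681233171710513486636686002056350821266286615777435636670337152342133179178274834242778,
  -78854644890966781250147829490613016595232749072235672798310662618226694252169766983036496760380947697793883723771,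
  7166204544439730784722217136077765428867812532710895988895193639618457543367950854644908788863884934262223110329,
  -620867379292438699735789724972337666726509464785215339334347418392719254242008613720338356743335451413697864790,
  51210218315456466258379822904932024062747763774571557788672299822563840103113760762019354190981680409212515138,
  -4015222514508231494829274052559122024142272618545167418925183736853976943724006955259033518319777121995424299,
  298775401594327228102304398507517973688008808979652868397724954687313895131189136539936677318521067755455196,
  -21061116983509756694504666113951896936055677411860645183529818957003400908854229291763692406382121220403659,
  1403657501981844957377357210201953773957791740402445662654786055060088251799434890812072053021095158043041,
  -88254630090663782782154946493465610976441723631131247862222170873194566118737268947631166178616129106804,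
  5222301390022170991389464289869691888891188818594501579838980670408087366324632853254617112059538140492,
  -290046491992542731920519778040486039797301548091361152293897375176604139216930958557485021113318926989,
  15074719386002921963007034949070389874138984492717734315918678205592221327482185260188013133756592105,
  -730698016085961085624553473264337505754097306615026003566825246787693864491745752821885279163418649,
  32905594442034909801189759894909052681901258859523662227593741582291454989541881371134104073361893,
  -1370709321893053060310584894971774514203875912873297776564161875197797598091439549122323902262720,
  52550628209067915693461559025698031002040029090161148897217106199067494911697338612369200891560,
  -1843418384123180141472020573211934118191687028525196287016778958982635055914336932621303207717,
  58761149804419045561779593359985534886833343076708629404133378774690039176340500087364335561,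
  -1688129232997437985912361017478589095206150825941750166234977274672711347072588619548376476,
  43275047452844110303748837512673196811006442347354587899737482969359539642014400986419740,
  -977738058071440884184558663465874164252090043161196839541458139053337078933027766900709,
  19166919319944057891464236158966810889822187983026209264019314976114307667324031222243,
  -319376325125965357924809497656237282013354252469775032684616568600971126907986135616,
  4398143508454315154324180991306399434013731229947266820272225610613899958882357181,
  -48056617636627308447734878448495527997621887321601595346485690145613700844404548,
  390620066765972932650183755000505875482362060951571086065665732175218870275126,
  -2099662975857651665582818330848801277852178608694320127170754339655549863494,
  5597934259155092123154899028141125924946261293754281248697527202733184097]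

/-- The approximate density, as a polynomial in `w = 2x+2`, scaled by `10^136`. -/
def cP : List ℤ := der (0 :: der cS)

def cR0 : List ℤ := rgen 6 200 0
  408248290463863016366214012450981898660991246776111688072115427875160062909552504423309905517440039136432434

def cR1 : List ℤ := rgen 10 140 0
  316227766016837933199889354443271853371955513932521682685750485279259443863923822134424810837930029518734728

def cR2 : List ℤ := rgen 14 125 0
  267261241912424384684553480879753521554001414841337639021696104808573939736209930569772135371027112250070792

/-! ### The certificate -/

def cE : List ℤ := (split cP).1
def cO : List ℤ := (split cP).2

/-- `10^108` times the polynomial approximating the `k`-th branch of the transfer operator. -/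
def cB (v : ℤ) (r : List ℤ) : List ℤ :=
  padd (smul (10 ^ 108) (pcomp v 2 cO)) (pmul (pcomp v 2 cE) r)

/-- The residual polynomial (never computed as a list). -/
def cQ : List ℤ :=
  padd (smul (-10 ^ 108) (pcomp 3 1 cP)) (padd (cB 6 cR0) (padd (cB 10 cR1) (cB 14 cR2)))

def bB (v : ℕ) (r : List ℤ) : ℕ :=
  10 ^ 108 * nev (v + 2) cO + nev (v + 2) cE * nev 1 r

def bQ : ℕ := 10 ^ 108 * nev 4 cP + (bB 6 cR0 + (bB 10 cR1 + bB 14 cR2))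

/-- The base used for the Kronecker substitution. -/
def cN : ℕ := 2 ^ 1150

def zB (v : ℤ) (r : List ℤ) : ℤ :=
  10 ^ 108 * evI cO (v + 2 * (cN : ℤ)) + evI cE (v + 2 * (cN : ℤ)) * evI r cN

/-- The value of `cQ` at the base. -/
def zQ : ℤ :=
  -10 ^ 108 * evI cP (3 + (cN : ℤ)) + (zB 6 cR0 + (zB 10 cR1 + zB 14 cR2))

/-- The coefficients of the residual polynomial. -/
def cC : List ℤ := dig (2 ^ 1150) (2 ^ 1149) 263 zQ

def cD (v : ℤ) (r : List ℤ) : List ℤ := padd (pmul [v, 2] (der r)) r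

theorem chk_value : evI cC (cN : ℤ) = zQ := by decide +kernel

theorem chk_size : bQ + nev 1 cC < cN := by decide +kernel

theorem chk_D0 : nev 1 (cD 6 cR0) ≤ 10 ^ 14 := by decide +kernel
theorem chk_D1 : nev 1 (cD 10 cR1) ≤ 10 ^ 12 := by decide +kernel
theorem chk_D2 : nev 1 (cD 14 cR2) ≤ 10 ^ 5 := by decide +kernel

/-- The total bound for the residual. -/
theorem chk_total : 2 * (lipb 1 cC + (10 ^ 14 * (nev (6 + 2) cE + 2 * lipb (6 + 2) cE) +
    (10 ^ 12 * (nev (10 + 2) cE + 2 * lipb (10 + 2) cE) + 10 ^ 5 * (nev (14 + 2) cE + 2 * lipb (14 + 2) cE))))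
      ≤ 10 ^ 191 := by decide +kernel

theorem chk_mean : evI (0 :: der cS) 4 - evI (0 :: der cS) 2 = 2 * 10 ^ 136 := by decide +kernel

/-- `10^70 * log 2`, rounded. -/
def cL : ℤ := 6931471805599453094172321214581765680755001343602552541206800094933936

/-- Twice the coefficient of `log 2` in the entropy of the approximate density. -/
def zA : ℤ := 2 * evI (0 :: der cS) 4 - evI (0 :: der cS) 2

theorem chk_A : zA.natAbs ≤ 10 ^ 138 := by decide +kernel

theorem chk_ent : (zA * cL - (evI cS 4 - evI cS 2) * 10 ^ 70 -
    2 * 105631307407297055209956887706406516793354262184005 * 10 ^ 156).natAbs ≤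
      144 * 10 ^ 154 := by decide +kernel

theorem log_two_bound : |Real.log 2 - cL / 10 ^ 70| ≤ 1 / 10 ^ 60 := by
  have h1 := Real.sum_range_le_log_div (x := 1 / 3) (by norm_num) (by norm_num) 66
  have h2 := Real.log_div_le_sum_range_add (x := 1 / 3) (by norm_num) (by norm_num) 66
  have e : ((1 : ℝ) + 1 / 3) / (1 - 1 / 3) = 2 := by norm_num
  rw [e] at h1 h2
  norm_num [Finset.sum_range_succ] at h1 h2
  unfold cL
  rw [abs_le]
  constructor <;> norm_num <;> linarith

/-! ### The residual of the approximate density -/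

theorem ev_cQ (x : ℝ) : ev cQ x = ev cC x := by
  have hb : ∀ (v : ℕ) (r : List ℤ), nev 1 (cB v r) ≤ bB v r := by
    intro v r
    unfold cB bB
    refine (nev_padd _ _).trans ?_
    rw [nev_smul]
    have h1 := nev_pcomp v 2 cO
    have h2 := nev_pcomp v 2 cE
    have h3 := nev_pmul (pcomp v 2 cE) r
    have e : (v : ℤ).natAbs + (2 : ℤ).natAbs = v + 2 := by simp
    rw [e] at h1 h2
    have e10 : ((10 : ℤ) ^ 108).natAbs = 10 ^ 108 := by norm_num
    rw [e10]
    exact add_le_add (Nat.mul_le_mul_left _ h1) (h3.trans (Nat.mul_le_mul_right _ h2))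
  have hQ : nev 1 cQ ≤ bQ := by
    unfold cQ bQ
    refine (nev_padd _ _).trans (add_le_add ?_ ?_)
    · rw [nev_smul]
      have e10 : (-(10 : ℤ) ^ 108).natAbs = 10 ^ 108 := by norm_num
      rw [e10]
      exact Nat.mul_le_mul_left _ (nev_pcomp 3 1 cP)
    · refine (nev_padd _ _).trans (add_le_add (hb 6 cR0) ?_)
      exact (nev_padd _ _).trans (add_le_add (hb 10 cR1) (hb 14 cR2))
  have hz : ∀ (v : ℤ) (r : List ℤ), ev (cB v r) (cN : ℤ) = zB v r := by
    intro v r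
    unfold cB zB
    rw [ev_padd, ev_smul, ev_pmul, ev_pcomp, ev_pcomp, evI_eq, evI_eq, evI_eq]
    simp only [Int.cast_id]
  have hzQ : ev cQ (cN : ℤ) = zQ := by
    unfold cQ zQ
    rw [ev_padd, ev_padd, ev_padd, hz, hz, hz, ev_smul, ev_pcomp, evI_eq]
    simp only [Int.cast_id, one_mul]
  have k := kron cN (padd cQ (smul (-1) cC)) (by
      refine lt_of_le_of_lt (nev_padd _ _) ?_
      rw [nev_smul]
      have := chk_size
      have e1 : (-1 : ℤ).natAbs * nev 1 cC = nev 1 cC := by simp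
      rw [e1]
      omega)
    (by rw [ev_padd, ev_smul, hzQ, ← evI_eq, chk_value]; simp) x
  rw [ev_padd, ev_smul] at k
  push_cast at k
  linarith

/-- The scaled error of the approximation of `1/√(v+2u)`. -/
noncomputable def err (v : ℕ) (r : List ℤ) (u : ℝ) : ℝ :=
  10 ^ 108 * (1 / √(v + 2 * u)) - ev r u

theorem err_bound {v d : ℕ} {r : List ℤ} (hv : 6 ≤ v) (hD : nev 1 (cD v r) ≤ d)
    (r0 : ℤ) (hr0 : ev r (0 : ℝ) = r0) (hr0p : 0 ≤ r0)
    (hq : 2 * ((10 : ℤ) ^ 216 - v * r0 ^ 2).natAbs ≤ d * 10 ^ 108) :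
    (∀ u ∈ Set.Icc (-1 : ℝ) 1, |err v r u| ≤ d) ∧
    ∀ u ∈ Set.Icc (-1 : ℝ) 1, ∀ w ∈ Set.Icc (-1 : ℝ) 1, |err v r u - err v r w| ≤ d * |u - w| := by
  have hv' : (6 : ℝ) ≤ v := by exact_mod_cast hv
  have hs2 : ∀ u ∈ Set.Icc (-1 : ℝ) 1, 2 ≤ √(v + 2 * u) := by
    intro u hu
    apply Real.le_sqrt_of_sq_le
    linarith [hu.1]
  have hd0 : (0 : ℝ) ≤ d := Nat.cast_nonneg d
  set G : ℝ → ℝ := fun u => 10 ^ 108 - √(v + 2 * u) * ev r u with hG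
  have hGd : ∀ u ∈ Set.Icc (-1 : ℝ) 1,
      HasDerivWithinAt G (-(ev (cD v r) u / √(v + 2 * u))) (Set.Icc (-1 : ℝ) 1) u := by
    intro u hu
    have hpos : (v : ℝ) + 2 * u ≠ 0 := by have := hu.1; intro h; linarith
    have hs := hs2 u hu
    have h1 : HasDerivAt (fun u : ℝ => (v : ℝ) + 2 * u) 2 u := by
      simpa using ((hasDerivAt_id u).const_mul (2 : ℝ)).const_add (v : ℝ)
    have h2 := ((h1.sqrt hpos).mul (ev_hasDerivAt r u)).const_sub (10 ^ 108)
    refine (h2.congr_deriv ?_).hasDerivWithinAt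
    have hsq : √(v + 2 * u) ^ 2 = v + 2 * u := Real.sq_sqrt (by linarith [hu.1])
    have ed : ev (cD v r) u = (v + 2 * u) * ev (der r) u + ev r u := by
      unfold cD
      rw [ev_padd, ev_pmul]
      simp only [ev]
      push_cast
      ring
    rw [ed]
    generalize √((v : ℝ) + 2 * u) = s at *
    have hs0 : s ≠ 0 := by positivity
    rw [← hsq]
    field_simp
    ring
  have hGb : ∀ u ∈ Set.Icc (-1 : ℝ) 1, ‖-(ev (cD v r) u / √(v + 2 * u))‖ ≤ d / 2 := by
    intro u hu
    have hs := hs2 u hu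
    rw [norm_neg, Real.norm_eq_abs, abs_div, abs_of_nonneg (Real.sqrt_nonneg _)]
    have hb : |ev (cD v r) u| ≤ d :=
      (nev_bound (b := 1) _ (by rw [abs_le]; simpa using hu)).trans (by exact_mod_cast hD)
    gcongr
  have hGl : ∀ u ∈ Set.Icc (-1 : ℝ) 1, ∀ w ∈ Set.Icc (-1 : ℝ) 1,
      |G u - G w| ≤ d / 2 * |u - w| := by
    intro u hu w hw
    exact Convex.norm_image_sub_le_of_norm_hasDerivWithin_le hGd hGb (convex_Icc _ _) hw hu
  have hG0 : |G 0| ≤ d / 2 := by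
    have e : G 0 = 10 ^ 108 - √v * r0 := by simp [hG, hr0]
    have hr : (0 : ℝ) ≤ r0 := by exact_mod_cast hr0p
    have hm : (10 ^ 108 - √v * r0) * (10 ^ 108 + √v * r0) = (10 : ℝ) ^ 216 - v * r0 ^ 2 := by
      have := Real.sq_sqrt (show (0 : ℝ) ≤ v by linarith)
      linear_combination (-(r0 : ℝ) ^ 2) * this
    have hq' : 2 * |(10 : ℝ) ^ 216 - v * r0 ^ 2| ≤ d * 10 ^ 108 := by
      have : ((2 * ((10 : ℤ) ^ 216 - v * r0 ^ 2).natAbs : ℕ) : ℝ) ≤ ((d * 10 ^ 108 : ℕ) : ℝ) := by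
        exact_mod_cast hq
      rw [Nat.cast_mul, natAbs_cast, Nat.cast_mul, Nat.cast_pow, Int.cast_sub, Int.cast_mul,
        Int.cast_pow, Int.cast_pow, Int.cast_natCast] at this
      exact this
    rw [← hm, abs_mul] at hq'
    have hge : (10 : ℝ) ^ 108 ≤ |10 ^ 108 + √v * r0| := by
      rw [abs_of_nonneg (by positivity)]
      have : 0 ≤ √v * r0 := by positivity
      linarith
    rw [e]
    have h3 := mul_le_mul_of_nonneg_left hge (abs_nonneg (10 ^ 108 - √v * (r0 : ℝ)))
    have h4 : ((2 : ℝ) * |(10 : ℝ) ^ 108 - √v * (r0 : ℝ)|) * 10 ^ 108 ≤ (d : ℝ) * 10 ^ 108 := by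
      linarith
    have h5 := le_of_mul_le_mul_right h4 (by positivity)
    rw [le_div_iff₀ (by norm_num), mul_comm]
    exact h5
  have hGs : ∀ u ∈ Set.Icc (-1 : ℝ) 1, |G u| ≤ d := by
    intro u hu
    have h := hGl u hu 0 (by simp)
    rw [sub_zero] at h
    have hu1 : |u| ≤ 1 := by rw [abs_le]; simpa using hu
    have := abs_sub_abs_le_abs_sub (G u) (G 0)
    nlinarith
  have eE : ∀ u ∈ Set.Icc (-1 : ℝ) 1, err v r u = G u * (1 / √(v + 2 * u)) := by
    intro u hu
    have : √(v + 2 * u) ≠ 0 := by have := hs2 u hu; positivity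
    simp only [err, hG]
    field_simp
  have hi : ∀ u ∈ Set.Icc (-1 : ℝ) 1, |1 / √(v + 2 * u)| ≤ 1 / 2 := by
    intro u hu
    rw [abs_of_nonneg (by positivity)]
    exact one_div_le_one_div_of_le (by norm_num) (hs2 u hu)
  constructor
  · intro u hu
    rw [eE u hu, abs_mul]
    nlinarith [mul_le_mul (hGs u hu) (hi u hu) (abs_nonneg _) hd0]
  · intro u hu w hw
    rw [eE u hu, eE w hw]
    have ha := hs2 u hu
    have hb := hs2 w hw
    have hlip : |1 / √(v + 2 * u) - 1 / √(v + 2 * w)| ≤ 1 / 2 * |u - w| := by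
      have sa : √(v + 2 * u) ^ 2 = v + 2 * u := Real.sq_sqrt (by linarith [hu.1])
      have sb : √(v + 2 * w) ^ 2 = v + 2 * w := Real.sq_sqrt (by linarith [hw.1])
      set a := √(v + 2 * u)
      set b := √(v + 2 * w)
      have e1 : 1 / a - 1 / b = (w - u) * (2 / ((a + b) * (a * b))) := by
        have : b ^ 2 - a ^ 2 = 2 * (w - u) := by rw [sa, sb]; ring
        have hab : a + b ≠ 0 := by positivity
        have ha0 : a ≠ 0 := by positivity
        have hb0 : b ≠ 0 := by positivity
        field_simp
        linear_combination this
      rw [e1, abs_mul, abs_sub_comm, mul_comm, abs_of_nonneg (by positivity)]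
      refine mul_le_mul_of_nonneg_right ?_ (abs_nonneg _)
      have hab : 4 ≤ a * b := by nlinarith
      rw [div_le_div_iff₀ (by positivity) (by norm_num)]
      nlinarith [mul_le_mul (show 4 ≤ a + b by linarith) hab (by norm_num) (by linarith)]
    have e2 : G u * (1 / √(v + 2 * u)) - G w * (1 / √(v + 2 * w)) =
        (G u - G w) * (1 / √(v + 2 * u)) + G w * (1 / √(v + 2 * u) - 1 / √(v + 2 * w)) := by ring
    rw [e2]
    refine (abs_add_le _ _).trans ?_
    rw [abs_mul, abs_mul]
    have t1 := mul_le_mul (hGl u hu w hw) (hi u hu) (abs_nonneg _) (by positivity)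
    have t2 := mul_le_mul (hGs w hw) hlip (abs_nonneg _) hd0
    nlinarith [mul_nonneg hd0 (abs_nonneg (u - w))]

theorem prod_lip {v d : ℕ} {p : List ℤ} {e : ℝ → ℝ}
    (h1 : ∀ u ∈ Set.Icc (-1 : ℝ) 1, |e u| ≤ d)
    (h2 : ∀ u ∈ Set.Icc (-1 : ℝ) 1, ∀ w ∈ Set.Icc (-1 : ℝ) 1, |e u - e w| ≤ d * |u - w|) :
    ∀ u ∈ Set.Icc (-1 : ℝ) 1, ∀ w ∈ Set.Icc (-1 : ℝ) 1,
      |ev p ((v : ℝ) + 2 * u) * e u - ev p ((v : ℝ) + 2 * w) * e w| ≤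
        (d * (nev (v + 2) p + 2 * lipb (v + 2) p) : ℕ) * |u - w| := by
  intro u hu w hw
  have hb : ∀ u ∈ Set.Icc (-1 : ℝ) 1, |(v : ℝ) + 2 * u| ≤ ((v + 2 : ℕ) : ℝ) := by
    intro u hu
    have : (0 : ℝ) ≤ v := Nat.cast_nonneg v
    push_cast
    rw [abs_le]; constructor <;> linarith [hu.1, hu.2]
  have a1 := nev_bound p (hb u hu)
  have a2 := lipb_bound p (hb u hu) (hb w hw)
  have e0 : (v : ℝ) + 2 * u - (v + 2 * w) = 2 * (u - w) := by ring
  rw [e0, abs_mul, abs_of_pos (by norm_num : (0 : ℝ) < 2)] at a2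
  have e2 : ev p ((v : ℝ) + 2 * u) * e u - ev p ((v : ℝ) + 2 * w) * e w =
      ev p ((v : ℝ) + 2 * u) * (e u - e w) +
        (ev p ((v : ℝ) + 2 * u) - ev p ((v : ℝ) + 2 * w)) * e w := by ring
  rw [e2]
  refine (abs_add_le _ _).trans ?_
  rw [abs_mul, abs_mul]
  have t1 := mul_le_mul a1 (h2 u hu w hw) (abs_nonneg _) (Nat.cast_nonneg _)
  have t2 := mul_le_mul a2 (h1 w hw) (abs_nonneg _) (by positivity)
  push_cast
  nlinarith

/-- The approximate density. -/
noncomputable def dens (x : ℝ) : ℝ := ev cP (2 * x + 2) / 10 ^ 136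

theorem dens_lip : ∃ M, 0 ≤ M ∧ LipOn M dens := by
  refine ⟨lipb 4 cP * 2 / 10 ^ 136, by positivity, fun x hx y hy => ?_⟩
  have hb : ∀ x ∈ Set.Icc (0 : ℝ) 1, |2 * x + 2| ≤ ((4 : ℕ) : ℝ) := by
    intro x hx
    push_cast
    rw [abs_le]; constructor <;> linarith [hx.1, hx.2]
  have h := lipb_bound cP (hb x hx) (hb y hy)
  have e0 : 2 * x + 2 - (2 * y + 2) = 2 * (x - y) := by ring
  rw [e0, abs_mul, abs_of_pos (by norm_num : (0 : ℝ) < 2)] at h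
  unfold dens
  rw [← sub_div, abs_div, abs_of_pos (by positivity : (0 : ℝ) < 10 ^ 136), div_mul_eq_mul_div]
  gcongr
  linarith

theorem branch_eq (k : ℕ) (r : List ℤ) {x : ℝ} (hx : x ∈ Set.Icc (0 : ℝ) 1) :
    10 ^ 244 * (1 / (2 * √(x + 1 + k)) * dens (√(x + 1 + k) - 1)) =
      ev (cB ((6 + 4 * k : ℕ) : ℤ) r) (2 * x - 1) +
        ev cE (((6 + 4 * k : ℕ) : ℝ) + 2 * (2 * x - 1)) * err (6 + 4 * k) r (2 * x - 1) := by
  have hx0 := hx.1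
  have hz : 0 < x + 1 + (k : ℝ) := by positivity
  have hs : 0 < √(x + 1 + (k : ℝ)) := Real.sqrt_pos.mpr hz
  have e4 : ((6 + 4 * k : ℕ) : ℝ) + 2 * (2 * x - 1) = (2 * √(x + 1 + k)) ^ 2 := by
    rw [mul_pow, Real.sq_sqrt hz.le]; push_cast; ring
  have es : √(((6 + 4 * k : ℕ) : ℝ) + 2 * (2 * x - 1)) = 2 * √(x + 1 + k) := by
    rw [e4, Real.sqrt_sq (by positivity)]
  unfold cB err dens
  rw [ev_padd, ev_smul, ev_pmul, ev_pcomp, ev_pcomp, es]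
  have e5 : (((6 + 4 * k : ℕ) : ℤ) : ℝ) + ((2 : ℤ) : ℝ) * (2 * x - 1) = (2 * √(x + 1 + k)) ^ 2 := by
    rw [← e4]; push_cast; ring
  rw [e5, e4]
  have e6 : 2 * (√(x + 1 + k) - 1) + 2 = 2 * √(x + 1 + (k : ℝ)) := by ring
  rw [e6, ev_split cP]
  change _ = ((10 ^ 108 : ℤ) : ℝ) * ev cO _ + _ + _
  change 10 ^ 244 * (1 / (2 * √(x + 1 + k)) * ((ev cE _ + _ * ev cO _) / 10 ^ 136)) = _
  generalize ev cE ((2 * √(x + 1 + (k : ℝ))) ^ 2) = A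
  generalize ev cO ((2 * √(x + 1 + (k : ℝ))) ^ 2) = B
  generalize ev r (2 * x - 1) = r'
  push_cast
  field_simp
  ring

theorem residual_eq {x : ℝ} (hx : x ∈ Set.Icc (0 : ℝ) 1) :
    10 ^ 244 * (Lop dens x - dens x) = ev cC (2 * x - 1) +
      (ev cE (((6 : ℕ) : ℝ) + 2 * (2 * x - 1)) * err 6 cR0 (2 * x - 1) +
      (ev cE (((10 : ℕ) : ℝ) + 2 * (2 * x - 1)) * err 10 cR1 (2 * x - 1) +
      ev cE (((14 : ℕ) : ℝ) + 2 * (2 * x - 1)) * err 14 cR2 (2 * x - 1))) := by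
  rw [← ev_cQ]
  have b0 := branch_eq 0 cR0 hx
  have b1 := branch_eq 1 cR1 hx
  have b2 := branch_eq 2 cR2 hx
  have e3 : 10 ^ 244 * dens x = 10 ^ 108 * ev (pcomp 3 1 cP) (2 * x - 1) := by
    rw [ev_pcomp]
    have : ((3 : ℤ) : ℝ) + ((1 : ℤ) : ℝ) * (2 * x - 1) = 2 * x + 2 := by push_cast; ring
    rw [this]
    unfold dens
    generalize ev cP (2 * x + 2) = A
    field_simp
  unfold cQ
  rw [ev_padd, ev_padd, ev_padd, ev_smul]
  unfold Lop
  rw [Finset.sum_range_succ, Finset.sum_range_succ, Finset.sum_range_one, mul_sub, mul_add, mul_add,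
    b0, b1, b2, e3]
  norm_num
  ring

theorem residual_lip : LipOn (1 / 10 ^ 53) (fun x => Lop dens x - dens x) := by
  intro x hx y hy
  have hu : 2 * x - 1 ∈ Set.Icc (-1 : ℝ) 1 := ⟨by linarith [hx.1], by linarith [hx.2]⟩
  have hw : 2 * y - 1 ∈ Set.Icc (-1 : ℝ) 1 := ⟨by linarith [hy.1], by linarith [hy.2]⟩
  have E0 := err_bound (v := 6) (by norm_num) chk_D0 (evI cR0 0)
    (by rw [← ev_intCast]; norm_num) (by decide +kernel) (by decide +kernel)
  have E1 := err_bound (v := 10) (by norm_num) chk_D1 (evI cR1 0)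
    (by rw [← ev_intCast]; norm_num) (by decide +kernel) (by decide +kernel)
  have E2 := err_bound (v := 14) (by norm_num) chk_D2 (evI cR2 0)
    (by rw [← ev_intCast]; norm_num) (by decide +kernel) (by decide +kernel)
  have P0 := prod_lip (p := cE) (v := 6) E0.1 E0.2 _ hu _ hw
  have P1 := prod_lip (p := cE) (v := 10) E1.1 E1.2 _ hu _ hw
  have P2 := prod_lip (p := cE) (v := 14) E2.1 E2.2 _ hu _ hw
  have P3 := lipb_bound cC (b := 1) (x := 2 * x - 1) (y := 2 * y - 1)
    (by rw [abs_le]; simpa using hu) (by rw [abs_le]; simpa using hw)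
  have ex := residual_eq hx
  have ey := residual_eq hy
  have hd : |(2 * x - 1) - (2 * y - 1)| = 2 * |x - y| := by
    rw [show (2 * x - 1) - (2 * y - 1) = 2 * (x - y) by ring, abs_mul,
      abs_of_pos (by norm_num : (0 : ℝ) < 2)]
  rw [hd] at P0 P1 P2 P3
  have tot : ((2 * (lipb 1 cC + (10 ^ 14 * (nev (6 + 2) cE + 2 * lipb (6 + 2) cE) +
    (10 ^ 12 * (nev (10 + 2) cE + 2 * lipb (10 + 2) cE) +
      10 ^ 5 * (nev (14 + 2) cE + 2 * lipb (14 + 2) cE)))) : ℕ) : ℝ) ≤ ((10 ^ 191 : ℕ) : ℝ) :=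
    Nat.cast_le.mpr chk_total
  rw [Nat.cast_mul, Nat.cast_add, Nat.cast_add, Nat.cast_add] at tot
  generalize ((10 ^ 14 * (nev (6 + 2) cE + 2 * lipb (6 + 2) cE) : ℕ) : ℝ) = A0 at *
  generalize ((10 ^ 12 * (nev (10 + 2) cE + 2 * lipb (10 + 2) cE) : ℕ) : ℝ) = A1 at *
  generalize ((10 ^ 5 * (nev (14 + 2) cE + 2 * lipb (14 + 2) cE) : ℕ) : ℝ) = A2 at *
  generalize ((lipb 1 cC : ℕ) : ℝ) = A3 at *
  have hsub : 10 ^ 244 * |(Lop dens x - dens x) - (Lop dens y - dens y)| ≤ 10 ^ 191 * |x - y| := by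
    rw [← abs_of_pos (by positivity : (0 : ℝ) < 10 ^ 244), ← abs_mul, mul_sub, ex, ey]
    have hxy := abs_nonneg (x - y)
    have hm := mul_le_mul_of_nonneg_right tot hxy
    push_cast at hm
    rw [abs_le] at *
    constructor <;> linarith [P0.1, P0.2, P1.1, P1.2, P2.1, P2.2, P3.1, P3.2]
  have e : (10 : ℝ) ^ 191 * |x - y| = 10 ^ 244 * (1 / 10 ^ 53 * |x - y|) := by
    norm_num; ring
  rw [e] at hsub
  exact le_of_mul_le_mul_left hsub (by positivity)

/-! ### The entropy of the approximate density -/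

theorem hasDeriv_lin (x : ℝ) : HasDerivAt (fun x : ℝ => 2 * x + 2) 2 x := by
  simpa using ((hasDerivAt_id x).const_mul (2 : ℝ)).add_const (2 : ℝ)

theorem dens_mean : ∫ x in Set.Ico (0 : ℝ) 1, dens x = 1 := by
  obtain ⟨M, -, hl⟩ := dens_lip
  rw [integral_Ico_eq_integral_Ioc, ← intervalIntegral.integral_of_le (by norm_num)]
  have hd : ∀ x ∈ Set.uIcc (0 : ℝ) 1,
      HasDerivAt (fun x : ℝ => ev (0 :: der cS) (2 * x + 2) / (2 * 10 ^ 136)) (dens x) x := by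
    intro x _
    have h := ((ev_hasDerivAt (0 :: der cS) (2 * x + 2)).comp x (hasDeriv_lin x)).div_const
      (2 * 10 ^ 136)
    refine h.congr_deriv ?_
    change ev cP _ * 2 / _ = ev cP _ / _
    field_simp
  rw [intervalIntegral.integral_eq_sub_of_hasDerivAt hd]
  · have h4 := ev_intCast (0 :: der cS) 4
    have h2 := ev_intCast (0 :: der cS) 2
    have hm : ((evI (0 :: der cS) 4 - evI (0 :: der cS) 2 : ℤ) : ℝ) = ((2 * 10 ^ 136 : ℤ) : ℝ) :=
      congrArg _ chk_mean
    rw [Int.cast_sub, ← h4, ← h2] at hm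
    push_cast at hm
    rw [show (2 : ℝ) * 1 + 2 = 4 by norm_num, show (2 : ℝ) * 0 + 2 = 2 by norm_num, ← sub_div, hm]
    norm_num
  · apply ContinuousOn.intervalIntegrable
    rw [Set.uIcc_of_le (by norm_num)]
    exact hl.continuousOn

theorem dens_entropy : ∫ x in Set.Ico (0 : ℝ) 1, Real.log (2 * x + 2) * dens x =
    (zA * Real.log 2 - (evI cS 4 - evI cS 2 : ℤ)) / (2 * 10 ^ 136) := by
  obtain ⟨M, -, hl⟩ := dens_lip
  rw [integral_Ico_eq_integral_Ioc, ← intervalIntegral.integral_of_le (by norm_num)]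
  have hd : ∀ x ∈ Set.uIcc (0 : ℝ) 1,
      HasDerivAt (fun x : ℝ => (ev (0 :: der cS) (2 * x + 2) * Real.log (2 * x + 2) -
        ev cS (2 * x + 2)) / (2 * 10 ^ 136)) (Real.log (2 * x + 2) * dens x) x := by
    intro x hx
    rw [Set.uIcc_of_le (by norm_num)] at hx
    have hne : 2 * x + 2 ≠ 0 := by have := hx.1; positivity
    have h1 := (ev_hasDerivAt (0 :: der cS) (2 * x + 2)).comp x (hasDeriv_lin x)
    have h2 := (ev_hasDerivAt cS (2 * x + 2)).comp x (hasDeriv_lin x)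
    have h3 := (hasDeriv_lin x).log hne
    have h := ((h1.mul h3).sub h2).div_const (2 * 10 ^ 136)
    refine h.congr_deriv ?_
    change (ev cP _ * 2 * Real.log _ + ((0 : ℤ) + (2 * x + 2) * ev (der cS) (2 * x + 2)) * _ - _) / _
      = _ * (ev cP _ / _)
    generalize ev cP (2 * x + 2) = A
    generalize ev (der cS) (2 * x + 2) = B
    generalize Real.log (2 * x + 2) = l
    generalize 2 * x + 2 = y at hne
    push_cast
    field_simp
    ring
  rw [intervalIntegral.integral_eq_sub_of_hasDerivAt hd]
  · have h4 := ev_intCast (0 :: der cS) 4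
    have h2 := ev_intCast (0 :: der cS) 2
    have s4 := ev_intCast cS 4
    have s2 := ev_intCast cS 2
    have hz : (zA : ℝ) = ((2 * evI (0 :: der cS) 4 - evI (0 :: der cS) 2 : ℤ) : ℝ) := rfl
    rw [hz, Int.cast_sub, Int.cast_mul, Int.cast_sub, ← h4, ← h2, ← s4, ← s2]
    push_cast
    rw [show (2 : ℝ) * 1 + 2 = 4 by norm_num, show (2 : ℝ) * 0 + 2 = 2 by norm_num, ← sub_div]
    have hl4 : Real.log 4 = 2 * Real.log 2 := by
      rw [show (4 : ℝ) = 2 ^ 2 by norm_num, Real.log_pow]; norm_num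
    rw [hl4]
    ring
  · apply ContinuousOn.intervalIntegrable
    rw [Set.uIcc_of_le (by norm_num)]
    refine ContinuousOn.mul ?_ hl.continuousOn
    refine ContinuousOn.log (by fun_prop) ?_
    intro x hx
    have := hx.1
    positivity

theorem dens_entropy_bound :
    |(∫ x in Set.Ico (0 : ℝ) 1, Real.log (2 * x + 2) * dens x) -
      1.05631307407297055209956887706406516793354262184005| ≤ 0.73e-50 := by
  rw [dens_entropy]
  have hA : |(zA : ℝ)| ≤ 10 ^ 138 := by
    rw [← natAbs_cast]
    exact_mod_cast chk_A
  have hE : |(((zA * cL - (evI cS 4 - evI cS 2) * 10 ^ 70 -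
      2 * 105631307407297055209956887706406516793354262184005 * 10 ^ 156 : ℤ)) : ℝ)| ≤
      144 * 10 ^ 154 := by
    rw [← natAbs_cast]
    exact_mod_cast chk_ent
  have hL := log_two_bound
  rw [Int.cast_sub, Int.cast_sub, Int.cast_mul, Int.cast_mul] at hE
  generalize ((evI cS 4 - evI cS 2 : ℤ) : ℝ) = b at *
  generalize (zA : ℝ) = a at *
  generalize (cL : ℝ) = c at *
  have hP : |a * (Real.log 2 - c / 10 ^ 70)| ≤ 10 ^ 78 := by
    rw [abs_mul]
    refine (mul_le_mul hA hL (abs_nonneg _) (by positivity)).trans (by norm_num)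
  have e : (a * Real.log 2 - b) / (2 * 10 ^ 136) -
      1.05631307407297055209956887706406516793354262184005 =
      (a * (Real.log 2 - c / 10 ^ 70)) / (2 * 10 ^ 136) +
      (a * c - b * ((10 ^ 70 : ℤ) : ℝ) -
        ((2 * 105631307407297055209956887706406516793354262184005 * 10 ^ 156 : ℤ) : ℝ)) /
        (2 * 10 ^ 206) := by
    push_cast
    ring
  rw [e]
  refine (abs_add_le _ _).trans ?_
  rw [abs_div, abs_div, abs_of_pos (by positivity : (0 : ℝ) < 2 * 10 ^ 136),
    abs_of_pos (by positivity : (0 : ℝ) < 2 * 10 ^ 206)]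
  refine (add_le_add (div_le_div_of_nonneg_right hP (by positivity))
    (div_le_div_of_nonneg_right hE (by positivity))).trans ?_
  norm_num

end BR

theorem entropy_estimate (μ : Measure ℝ) [IsProbabilityMeasure μ]
    (hsupp : μ (Set.Ico (0 : ℝ) 1)ᶜ = 0)
    (hinv : ∀ A : Set ℝ, MeasurableSet A → μ (T ⁻¹' A) = μ A)
    (hac : μ ≪ volume) :
    |(∫ x, Real.log (2 * x + 2) ∂μ) -
        1.05631307407297055209956887706406516793354262184005| ≤ 1e-50 := by
  obtain ⟨M, hM, hl⟩ := BR.dens_lip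
  have hφ : Measurable ((Set.Ico (0 : ℝ) 1).indicator fun x => Real.log (2 * x + 2)) :=
    Measurable.indicator (by fun_prop) measurableSet_Ico
  have hC : ∀ x, |(Set.Ico (0 : ℝ) 1).indicator (fun x => Real.log (2 * x + 2)) x| ≤ 3 := by
    intro x
    by_cases hx : x ∈ Set.Ico (0 : ℝ) 1
    · rw [Set.indicator_of_mem hx]
      have h0 : 0 ≤ Real.log (2 * x + 2) := Real.log_nonneg (by linarith [hx.1])
      rw [abs_of_nonneg h0]
      have := Real.log_le_sub_one_of_pos (show 0 < 2 * x + 2 by linarith [hx.1])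
      linarith [hx.2]
    · rw [Set.indicator_of_notMem hx]; norm_num
  have key := BR.abstract_bound μ hsupp hinv hac hφ hC hM hl BR.dens_mean
    (by positivity : (0 : ℝ) ≤ 1 / 10 ^ 53) BR.residual_lip
  have e1 : ∫ x, (Set.Ico (0 : ℝ) 1).indicator (fun x => Real.log (2 * x + 2)) x ∂μ =
      ∫ x, Real.log (2 * x + 2) ∂μ := by
    refine integral_congr_ae ?_
    have : ∀ᵐ x ∂μ, x ∈ Set.Ico (0 : ℝ) 1 := by rw [ae_iff]; exact hsupp
    filter_upwards [this] with x hx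
    rw [Set.indicator_of_mem hx]
  have e2 : ∫ x in Set.Ico (0 : ℝ) 1,
      (Set.Ico (0 : ℝ) 1).indicator (fun x => Real.log (2 * x + 2)) x * BR.dens x =
      ∫ x in Set.Ico (0 : ℝ) 1, Real.log (2 * x + 2) * BR.dens x := by
    refine setIntegral_congr_fun measurableSet_Ico fun x hx => ?_
    simp only [Set.indicator_of_mem hx]
  rw [e1, e2] at key
  have b := BR.dens_entropy_bound
  have hn : (12 : ℝ) * 3 * (1 / 10 ^ 53) + 0.73e-50 ≤ 1e-50 := by norm_num
  rw [abs_le] at *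
  constructor <;> linarith [key.1, key.2, b.1, b.2]
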